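/- Let n ≥ 5 and let M be an edge set of the complete graph K_n such that the subgraph K_n[M] induced by the edges of M is the vertex-disjoint union of a triangle C_3 and a single edge P_2. Then κ_3(K_n \ M) = n − 3. -/

import Mathlib

open SimpleGraph

/-- Trees `T 0, …, T (r-1)` are internally disjoint `S`-trees in `G`: each `T i` is a
subgraph of `G` that is a tree containing every vertex of `S`, the edge sets are pairwise
disjoint, and the vertex sets of any two distinct trees intersect exactly in `S`. -/
def IsInternallyDisjointSTrees {V : Type*} (G : SimpleGraph V) (S : Set V) {r : ℕ}
    (T : Fin r → G.Subgraph) : Prop :=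
  (∀ i, S ⊆ (T i).verts ∧ (T i).coe.IsTree) ∧
  Pairwise fun i j =>
    Disjoint (T i).edgeSet (T j).edgeSet ∧ (T i).verts ∩ (T j).verts = S

/-- The generalized `k`-connectivity `κ_k(G)`: the greatest positive integer `r` such that
for every set `S` of `k` vertices there are `r` internally disjoint `S`-trees in `G`. -/
noncomputable def genConn {V : Type*} (G : SimpleGraph V) (k : ℕ) : ℕ :=
  sSup {r : ℕ | 0 < r ∧ ∀ S : Finset V, S.card = k →
    ∃ T : Fin r → G.Subgraph, IsInternallyDisjointSTrees G (↑S) T}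

/-- `M` forms a path on 4 vertices `a - b - c - d`. -/
def IsP4Edges {V : Type*} (M : Set (Sym2 V)) : Prop :=
  ∃ a b c d : V, [a, b, c, d].Nodup ∧ M = {s(a, b), s(b, c), s(c, d)}

/-- `M` forms the vertex-disjoint union of a path on 3 vertices `a - b - c`
and a single edge `d - e`. -/
def IsP3UnionP2Edges {V : Type*} (M : Set (Sym2 V)) : Prop :=
  ∃ a b c d e : V, [a, b, c, d, e].Nodup ∧ M = {s(a, b), s(b, c), s(d, e)}

/-- `M` forms the vertex-disjoint union of a triangle on `a, b, c`
and a single edge `d - e`. -/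
def IsC3UnionP2Edges {V : Type*} (M : Set (Sym2 V)) : Prop :=
  ∃ a b c d e : V, [a, b, c, d, e].Nodup ∧ M = {s(a, b), s(b, c), s(a, c), s(d, e)}

/-- `M` is a matching: no two distinct members of `M` share a vertex. -/
def IsMatchingEdges {V : Type*} (M : Set (Sym2 V)) : Prop :=
  M.Pairwise fun e f => ∀ v : V, v ∈ e → v ∉ f

namespace SimpleGraph

variable {V : Type*}

theorem Subgraph.Connected.exists_isTree_le {G : SimpleGraph V} {H : G.Subgraph}
    (h : H.Connected) [Finite V] :
    ∃ T : G.Subgraph, T ≤ H ∧ T.verts = H.verts ∧ T.coe.IsTree := by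
  obtain ⟨T, hT, hTree⟩ := h.coe.exists_isTree_le
  refine ⟨{ verts := H.verts
            Adj := fun u v => ∃ (hu : u ∈ H.verts) (hv : v ∈ H.verts), T.Adj ⟨u, hu⟩ ⟨v, hv⟩
            adj_sub := fun ⟨_, _, h⟩ => H.adj_sub (hT h)
            edge_vert := fun ⟨hu, _, _⟩ => hu
            symm := ⟨fun _ _ ⟨hu, hv, h⟩ => ⟨hv, hu, h.symm⟩⟩ },
    ⟨subset_rfl, fun _ _ ⟨_, _, h⟩ => hT h⟩, rfl, ?_⟩
  convert hTree using 1
  ext u v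
  exact ⟨fun ⟨_, _, h⟩ => h, fun h => ⟨u.2, v.2, h⟩⟩

theorem Subgraph.connected_of_dist_le_two {G : SimpleGraph V} {H : G.Subgraph} {r : V}
    (hr : r ∈ H.verts)
    (h : ∀ u ∈ H.verts, u = r ∨ H.Adj u r ∨ ∃ v, H.Adj u v ∧ H.Adj v r) : H.Connected := by
  have reach : ∀ u : H.verts, H.coe.Reachable u ⟨r, hr⟩ := by
    rintro ⟨u, hu⟩
    rcases h u hu with rfl | h | ⟨v, h, h'⟩
    · rfl
    · exact Adj.reachable (G := H.coe) (by simpa using h)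
    · exact (Adj.reachable (G := H.coe) (v := ⟨v, H.edge_vert h'⟩) (by simpa using h)).trans
        (Adj.reachable (G := H.coe) (by simpa using h'))
  rw [Subgraph.connected_iff']
  have : Nonempty H.verts := ⟨⟨r, hr⟩⟩
  exact ⟨fun u v => (reach u).trans (reach v).symm⟩

/-- The subgraph of `G` on `S` and the vertices owned by `w`, whose edges inside `S` are the ones
coloured `w`. -/
def ownedSubgraph (G : SimpleGraph V) (S : Set V) (own : V → V) (col : Sym2 V → V) (w : V) :
    G.Subgraph where
  verts := {u | u ∈ S ∨ own u = w}
  Adj u v := G.Adj u v ∧ (u ∈ S ∨ own u = w) ∧ (v ∈ S ∨ own v = w) ∧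
    (u ∈ S → v ∈ S → col s(u, v) = w)
  adj_sub h := h.1
  edge_vert h := h.2.1
  symm := ⟨fun u v ⟨h, hu, hv, hc⟩ =>
    ⟨h.symm, hv, hu, fun h₁ h₂ => by rw [Sym2.eq_swap]; exact hc h₂ h₁⟩⟩

theorem exists_isInternallyDisjointSTrees [Fintype V] [DecidableEq V] {G : SimpleGraph V}
    {S : Finset V} {r : ℕ} (hr : Sᶜ.card = r) (own : V → V) (col : Sym2 V → V)
    (h : ∀ w ∉ S, (G.ownedSubgraph S own col w).Connected) :
    ∃ T : Fin r → G.Subgraph, IsInternallyDisjointSTrees G (↑S) T := by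
  let e := (Finset.equivFinOfCardEq hr).symm
  have he : ∀ i, (e i : V) ∉ S := fun i => Finset.mem_compl.1 (e i).2
  choose T hle hverts htree using fun i => (h (e i) (he i)).exists_isTree_le
  refine ⟨T, fun i => ⟨?_, htree i⟩, fun i j hij => ?_⟩
  · rw [hverts]
    exact fun u hu => Or.inl hu
  · have hne : (e i : V) ≠ e j := fun h => hij (e.injective (Subtype.ext h))
    constructor
    · rw [Set.disjoint_left]
      intro z
      induction z with | _ u v =>
      intro hi hj
      obtain ⟨-, hu, hv, hc⟩ := (hle i).2 hi
      obtain ⟨-, hu', hv', hc'⟩ := (hle j).2 hj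
      grind
    · rw [hverts, hverts]
      ext u
      simp only [ownedSubgraph, Set.mem_inter_iff, Set.mem_ofPred_eq]
      grind

theorem connected_ownedSubgraph_of_root {G : SimpleGraph V} {S : Set V} {own : V → V}
    {col : Sym2 V → V} {w r : V} (hr : r ∈ S ∨ own r = w)
    (h : ∀ u, u ∈ S ∨ own u = w → u = r ∨ (G.Adj u r ∧ (u ∈ S → r ∈ S → col s(u, r) = w)) ∨
      ∃ v, (v ∈ S ∨ own v = w) ∧ (G.Adj u v ∧ (u ∈ S → v ∈ S → col s(u, v) = w)) ∧
        (G.Adj v r ∧ (v ∈ S → r ∈ S → col s(v, r) = w))) :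
    (G.ownedSubgraph S own col w).Connected := by
  refine Subgraph.connected_of_dist_le_two hr fun u hu => ?_
  rcases h u hu with h | h | ⟨v, hv, h, h'⟩
  · exact Or.inl h
  · exact Or.inr (Or.inl ⟨h.1, hu, hr, h.2⟩)
  · exact Or.inr (Or.inr ⟨v, ⟨h.1, hu, hv, h.2⟩, h'.1, hv, hr, h'.2⟩)

theorem connected_ownedSubgraph_id {G : SimpleGraph V} {S : Finset V} {col : Sym2 V → V} {w : V}
    (hw : w ∉ S)
    (h : ∀ u ∈ S, G.Adj u w ∨ ∃ v ∈ S, G.Adj u v ∧ col s(u, v) = w ∧ G.Adj v w) :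
    (G.ownedSubgraph S id col w).Connected := by
  refine connected_ownedSubgraph_of_root (r := w) (Or.inr rfl) fun u hu => ?_
  simp only [SetLike.mem_coe, id] at hu ⊢
  rcases hu with hu | rfl
  · rcases h u hu with h | ⟨v, hv, h, hc, h'⟩
    · exact Or.inr (Or.inl ⟨h, fun _ h => absurd h hw⟩)
    · exact Or.inr (Or.inr ⟨v, Or.inl hv, ⟨h, fun _ _ => hc⟩, h', fun _ h => absurd h hw⟩)
  · exact Or.inl rfl

/-- If the non-edges of `G` form a triangle on `C` and a disjoint edge on `D`, then for every
`3`-set `S` there is an ownership and a colouring making all owned subgraphs connected. -/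
theorem exists_connected_ownedSubgraph [DecidableEq V] {G : SimpleGraph V} {S C D : Finset V}
    (hC : C.card = 3) (hD : D.card = 2) (hS : S.card = 3) (hCD : Disjoint C D)
    (hG : ∀ u v, G.Adj u v ↔ u ≠ v ∧ ¬(u ∈ C ∧ v ∈ C) ∧ ¬(u ∈ D ∧ v ∈ D)) :
    ∃ (own : V → V) (col : Sym2 V → V),
      ∀ w ∉ S, (G.ownedSubgraph S own col w).Connected := by
  have hcases : (S ∩ C).card = 0 ∨ (S ∩ C).card = 1 ∨ (S ∩ C).card = 2 ∨ (S ∩ C).card = 3 := by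
    have := Finset.card_le_card (Finset.inter_subset_left (s₁ := S) (s₂ := C))
    omega
  have hSc := Finset.card_sdiff_add_card_inter S C
  have hCs := Finset.card_sdiff_add_card_inter C S
  rw [Finset.inter_comm C S] at hCs
  rw [Finset.disjoint_left] at hCD
  obtain ⟨d, e, hde, rfl⟩ := Finset.card_eq_two.1 hD
  rcases hcases with h | h | h | h
  · rw [Finset.card_eq_zero, Finset.ext_iff] at h
    refine ⟨id, fun _ => if d ∈ S then e else d, fun w hw =>
      connected_ownedSubgraph_id hw fun u hu => ?_⟩
    obtain ⟨v, hv, hvu⟩ := Finset.exists_mem_ne (by omega : 1 < S.card) u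
    by_cases hadj : G.Adj u w
    · exact Or.inl hadj
    · refine Or.inr ⟨v, hv, ?_⟩
      simp only [hG, Finset.mem_insert, Finset.mem_singleton, Finset.mem_inter] at *
      grind
  · obtain ⟨p, hp⟩ := Finset.card_eq_one.1 h
    obtain ⟨y, z, hyz, hSeq⟩ := Finset.card_eq_two.1 (show (S \ C).card = 2 by omega)
    obtain ⟨b, c, hbc, hCeq⟩ := Finset.card_eq_two.1 (show (C \ S).card = 2 by omega)
    simp only [Finset.ext_iff, Finset.mem_inter, Finset.mem_sdiff, Finset.mem_insert,
      Finset.mem_singleton] at hp hSeq hCeq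
    refine ⟨id, fun s => if s = s(p, y) then b else if s = s(p, z) then c else
      if d ∈ S then e else d, fun w hw => connected_ownedSubgraph_id hw fun u hu => ?_⟩
    have hpS := (hp p).2 rfl
    have hyS := (hSeq y).2 (Or.inl rfl)
    have hzS := (hSeq z).2 (Or.inr rfl)
    have huS : u = p ∨ u = y ∨ u = z := by
      have := hp u
      have := hSeq u
      tauto
    have hwC : w ∈ C → w = b ∨ w = c := fun h => (hCeq w).1 ⟨h, hw⟩
    by_cases hadj : G.Adj u w
    · exact Or.inl hadj
    · right
      simp only [hG, Finset.mem_insert, Finset.mem_singleton, Sym2.eq_iff] at *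
      rcases huS with rfl | rfl | rfl
      · rcases hwC (by grind) with rfl | rfl
        · exact ⟨y, by grind⟩
        · exact ⟨z, by grind⟩
      · exact ⟨z, by grind⟩
      · exact ⟨y, by grind⟩
  · obtain ⟨p, q, hpq, hp⟩ := Finset.card_eq_two.1 h
    obtain ⟨y, hSeq⟩ := Finset.card_eq_one.1 (show (S \ C).card = 1 by omega)
    obtain ⟨c, hCeq⟩ := Finset.card_eq_one.1 (show (C \ S).card = 1 by omega)
    simp only [Finset.ext_iff, Finset.mem_inter, Finset.mem_sdiff, Finset.mem_insert,
      Finset.mem_singleton] at hp hSeq hCeq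
    have hyS := (hSeq y).2 rfl
    have hcS := (hCeq c).2 rfl
    have hS' : ∀ u ∈ S, u ∈ C ∨ u = y := fun u hu => by
      have := hSeq u
      tauto
    have hC' : ∀ u ∈ C, u ∈ S ∨ u = c := fun u hu => by
      have := hCeq u
      tauto
    simp only [Finset.mem_insert, Finset.mem_singleton] at *
    by_cases hy : y = d ∨ y = e
    · obtain ⟨f, hf, hfy⟩ : ∃ f, (f = d ∨ f = e) ∧ f ≠ y := by
        rcases hy with rfl | rfl
        exacts [⟨e, Or.inr rfl, hde.symm⟩, ⟨d, Or.inl rfl, hde⟩]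
      refine ⟨fun v => if v = c then f else v, fun _ => c, fun w hw => ?_⟩
      by_cases hwc : w = c
      · refine connected_ownedSubgraph_of_root (r := y) (by simp [hyS.1]) fun u hu => ?_
        simp only [SetLike.mem_coe, hG] at *
        grind
      · refine connected_ownedSubgraph_of_root (r := w) (by simp [hwc]) fun u hu => ?_
        simp only [SetLike.mem_coe, hG] at *
        by_cases huy : u = y ∧ w = f
        · exact Or.inr (Or.inr ⟨c, by grind⟩)
        · grind
    · refine ⟨id, fun _ => c, fun w hw => ?_⟩
      refine connected_ownedSubgraph_id hw fun u hu => ?_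
      by_cases hwc : w = c ∧ u ≠ y
      · refine Or.inr ⟨y, ?_⟩
        simp only [hG] at *
        grind
      · refine Or.inl ?_
        simp only [hG] at *
        grind
  · have hSC := Finset.sdiff_eq_empty_iff_subset.1
      (Finset.card_eq_zero.1 (show (S \ C).card = 0 by omega))
    have hCS := Finset.sdiff_eq_empty_iff_subset.1
      (Finset.card_eq_zero.1 (show (C \ S).card = 0 by omega))
    refine ⟨id, fun _ => d, fun w hw => connected_ownedSubgraph_id hw fun u hu => Or.inl ?_⟩
    grind

theorem card_le_degree_of_isInternallyDisjointSTrees {G : SimpleGraph V} {S : Set V} {r : ℕ}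
    {T : Fin r → G.Subgraph} (h : IsInternallyDisjointSTrees G S T) {a : V} (ha : a ∈ S)
    (hS : S.Nontrivial) [Fintype (G.neighborSet a)] : r ≤ G.degree a := by
  classical
  obtain ⟨b, hb, hba⟩ := hS.exists_ne a
  have key : ∀ i, ∃ x, (T i).Adj a x := fun i => by
    obtain ⟨hsub, htree⟩ := h.1 i
    have : Nontrivial (T i).verts := ⟨⟨a, hsub ha⟩, ⟨b, hsub hb⟩, by simpa using hba.symm⟩
    obtain ⟨x, hx⟩ := htree.connected.preconnected.exists_adj_of_nontrivial ⟨a, hsub ha⟩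
    exact ⟨x, by simpa using hx⟩
  choose f hf using key
  have hinj : Function.Injective f := fun i j hij => by
    by_contra hne
    exact Set.disjoint_left.1 (h.2 hne).1 (show s(a, f i) ∈ _ from hf i)
      (show s(a, f i) ∈ _ from hij ▸ hf j)
  rw [← Fintype.card_fin r, ← Finset.card_univ, ← Finset.card_image_of_injective _ hinj,
    ← card_neighborFinset_eq_degree]
  refine Finset.card_le_card fun x hx => ?_
  obtain ⟨i, -, rfl⟩ := Finset.mem_image.1 hx
  simpa using (hf i).adj_sub

end SimpleGraph

theorem genConn_three_delete_c3_union_p2 (n : ℕ) (hn : 5 ≤ n) (M : Set (Sym2 (Fin n)))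
    (hshape : IsC3UnionP2Edges M) :
    genConn ((⊤ : SimpleGraph (Fin n)).deleteEdges M) 3 = n - 3 := by
  obtain ⟨a, b, c, d, e, hnd, rfl⟩ := hshape
  simp only [List.nodup_cons, List.mem_cons, List.not_mem_nil, or_false, not_or] at hnd
  set G := (⊤ : SimpleGraph (Fin n)).deleteEdges {s(a, b), s(b, c), s(a, c), s(d, e)} with hGdef
  have hG : ∀ u v, G.Adj u v ↔ u ≠ v ∧ ¬(u ∈ ({a, b, c} : Finset (Fin n)) ∧
      v ∈ ({a, b, c} : Finset (Fin n))) ∧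
      ¬(u ∈ ({d, e} : Finset (Fin n)) ∧ v ∈ ({d, e} : Finset (Fin n))) := by
    intro u v
    simp only [hGdef, deleteEdges_adj, top_adj, Set.mem_insert_iff, Set.mem_singleton_iff,
      Sym2.eq_iff, Finset.mem_insert, Finset.mem_singleton]
    grind
  have hC : ({a, b, c} : Finset (Fin n)).card = 3 := by grind
  have hD : ({d, e} : Finset (Fin n)).card = 2 := by grind
  have hCD : Disjoint ({a, b, c} : Finset (Fin n)) {d, e} := by
    rw [Finset.disjoint_left]
    grind
  classical
  have hdeg : G.degree a = n - 3 := by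
    have : G.neighborFinset a = ({a, b, c} : Finset (Fin n))ᶜ := by
      ext v
      rw [mem_neighborFinset, hG, Finset.mem_compl]
      grind
    rw [← card_neighborFinset_eq_degree, this, Finset.card_compl, Fintype.card_fin, hC]
  refine IsGreatest.csSup_eq ⟨⟨by omega, fun S hS => ?_⟩, fun r hr => ?_⟩
  · obtain ⟨own, col, h⟩ := exists_connected_ownedSubgraph hC hD hS hCD hG
    exact exists_isInternallyDisjointSTrees
      (by rw [Finset.card_compl, Fintype.card_fin, hS]) own col h
  · obtain ⟨T, hT⟩ := hr.2 _ hC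
    rw [← hdeg]
    refine card_le_degree_of_isInternallyDisjointSTrees hT (by simp) ⟨a, by simp, b, by simp, ?_⟩
    exact hnd.1.1
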